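/- arXiv:1606.04461 — 2 statements merged into one kernel-verified Lean document; each statement's English description precedes it below -/
import Mathlib

section
/- Let k ≥ 6 be an even integer and G a 2r-regular finite simple graph of order n ≥ 3, where r ≥ 2. If n is odd, then the sum spectrum Σ_k(G) equals the set of even residues {0, 2, 4, …, k−2} in ℤ_k, i.e., Σ_k(G) = { c ∈ ℤ_k : c = 2m for some m ∈ ℤ_k }. -/
open Classical in
/-- The sum of the labels `ℓ s(v,u)` over all neighbors `u` of `v` in `G`. -/
noncomputable def vertexLabelSum {V : Type*} [Fintype V] (G : SimpleGraph V)
    {M : Type*} [AddCommMonoid M] (ℓ : Sym2 V → M) (v : V) : M :=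
  ∑ u ∈ Finset.univ.filter (fun u => G.Adj v u), ℓ s(v, u)

/-- `ℓ` is a `c`-sum `k`-magic labeling of `G`: it is nonzero on every edge of `G`
and the labels around every vertex sum to `c` in `ZMod k`. -/
def IsMagicLabeling {V : Type*} [Fintype V] (G : SimpleGraph V) (k : ℕ) (c : ZMod k)
    (ℓ : Sym2 V → ZMod k) : Prop :=
  (∀ e ∈ G.edgeSet, ℓ e ≠ 0) ∧ ∀ v : V, vertexLabelSum G ℓ v = c

/-- `G` is `c`-sum `k`-magic. -/
def IsSumMagic {V : Type*} [Fintype V] (G : SimpleGraph V) (k : ℕ) (c : ZMod k) : Prop :=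
  ∃ ℓ : Sym2 V → ZMod k, IsMagicLabeling G k c ℓ

/-- `G` is completely `k`-magic: `c`-sum `k`-magic for every `c ∈ ZMod k`. -/
def CompletelyMagic {V : Type*} [Fintype V] (G : SimpleGraph V) (k : ℕ) : Prop :=
  ∀ c : ZMod k, IsSumMagic G k c

/-- The sum spectrum of `G` with respect to `k`. -/
def sumSpectrum {V : Type*} [Fintype V] (G : SimpleGraph V) (k : ℕ) : Set (ZMod k) :=
  {c : ZMod k | IsSumMagic G k c}

open Classical in
/-- Degree of a vertex (classical, to avoid decidability assumptions). -/
noncomputable def degreeOf {V : Type*} [Fintype V] (G : SimpleGraph V) (v : V) : ℕ :=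
  (Finset.univ.filter (fun u => G.Adj v u)).card

/-- `G` is `r`-regular. -/
def IsRegularDeg {V : Type*} [Fintype V] (G : SimpleGraph V) (r : ℕ) : Prop :=
  ∀ v : V, degreeOf G v = r

/-- Additive homomorphisms commute with vertex sums. -/
theorem map_vertexLabelSum {V : Type*} [Fintype V] (G : SimpleGraph V) {M N : Type*}
    [AddCommMonoid M] [AddCommMonoid N] (f : M →+ N) (ℓ : Sym2 V → M) (v : V) :
    f (vertexLabelSum G ℓ v) = vertexLabelSum G (fun e => f (ℓ e)) v :=
  map_sum f _ _

open Classical in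
/-- Modulo 2 the vertex sums of a labeling add up to zero, since every edge is counted twice. -/
theorem sum_vertexLabelSum_zmod_two {V : Type*} [Fintype V] (G : SimpleGraph V)
    (ℓ : Sym2 V → ZMod 2) : ∑ v, vertexLabelSum G ℓ v = 0 := by
  have h : ∑ p ∈ Finset.univ.filter (fun p : V × V => G.Adj p.1 p.2), ℓ s(p.1, p.2) = 0 := by
    refine Finset.sum_involution (fun p _ => p.swap) ?_ ?_ ?_ ?_
    · intro p _
      rw [Prod.fst_swap, Prod.snd_swap, Sym2.eq_swap]
      exact CharTwo.add_self_eq_zero _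
    · rintro ⟨u, v⟩ hp - heq
      have huv : G.Adj u v := by simpa using hp
      exact huv.ne (congrArg Prod.snd heq)
    · intro p hp
      simpa [G.adj_comm] using hp
    · intro p _
      exact p.swap_swap
  rw [Finset.sum_filter, Fintype.sum_prod_type] at h
  simpa [vertexLabelSum, Finset.sum_filter] using h

/-- On a graph of odd order, only even constants occur as magic sums for an even modulus. -/
theorem IsSumMagic.exists_eq_two_mul {V : Type*} [Fintype V] {G : SimpleGraph V} {k : ℕ}
    [NeZero k] {c : ZMod k} (h : IsSumMagic G k c) (hk : Even k) (hodd : Odd (Fintype.card V)) :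
    ∃ m : ZMod k, c = 2 * m := by
  obtain ⟨ℓ, -, hsum⟩ := h
  let f := ZMod.castHom hk.two_dvd (ZMod 2)
  have h0 : ∑ v, f (vertexLabelSum G ℓ v) = 0 :=
    (Finset.sum_congr rfl fun v _ => map_vertexLabelSum G f.toAddMonoidHom ℓ v).trans
      (sum_vertexLabelSum_zmod_two G _)
  have hc : f c = 0 := by
    simpa [hsum, ZMod.natCast_eq_one_iff_odd.mpr hodd] using h0
  have hval : ((c.val : ℕ) : ZMod 2) = 0 := by
    rw [← hc, ← map_natCast f, ZMod.natCast_zmod_val]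
  obtain ⟨m, hm⟩ := (ZMod.natCast_eq_zero_iff _ _).mp hval
  exact ⟨m, by rw [← ZMod.natCast_zmod_val c, hm]; push_cast; rfl⟩

open Classical in
/-- A regular graph of positive degree has a permutation of its vertices moving every vertex
to one of its neighbors. -/
theorem IsRegularDeg.exists_perm_adj {V : Type*} [Fintype V] {G : SimpleGraph V} {d : ℕ}
    (hd : 0 < d) (hreg : IsRegularDeg G d) : ∃ σ : Equiv.Perm V, ∀ v, G.Adj v (σ v) := by
  let N : V → Finset V := fun v => Finset.univ.filter (fun u => G.Adj v u)
  have hcard : ∀ v, (N v).card = d := hreg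
  have hall : ∀ s : Finset V, s.card ≤ (s.biUnion N).card := by
    intro s
    refine Nat.le_of_mul_le_mul_right (c := d) ?_ hd
    refine Finset.card_mul_le_card_mul G.Adj ?_ ?_
    · intro v hv
      rw [← hcard v]
      refine Finset.card_le_card fun u hu => ?_
      exact (Finset.mem_bipartiteAbove G.Adj).mpr
        ⟨Finset.mem_biUnion.mpr ⟨v, hv, hu⟩, by simpa [N] using hu⟩
    · intro u _
      rw [← hcard u]
      refine Finset.card_le_card fun v hv => ?_
      simpa [N] using ((Finset.mem_bipartiteBelow G.Adj).mp hv).2.symm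
  obtain ⟨f, hinj, hf⟩ := (Finset.all_card_le_biUnion_card_iff_exists_injective N).mp hall
  exact ⟨Equiv.ofBijective f (Finite.injective_iff_bijective.mp hinj),
    fun v => by simpa [N] using hf v⟩

open Classical in
/-- The weight of a pair `s(x, y)` is the number of the relations `σ x = y`, `σ y = x` that hold. -/
noncomputable def permEdgeWeight {V : Type*} (R : Type*) [CommSemiring R] (σ : Equiv.Perm V) :
    Sym2 V → R :=
  Sym2.lift ⟨fun x y => (if σ x = y then 1 else 0) + (if σ y = x then 1 else 0),
    fun _ _ => add_comm _ _⟩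

open Classical in
/-- The edge weight of a permutation along `G` sums to two at every vertex. -/
theorem vertexLabelSum_permEdgeWeight {V : Type*} [Fintype V] {G : SimpleGraph V} (R : Type*)
    [CommSemiring R] {σ : Equiv.Perm V} (hσ : ∀ v, G.Adj v (σ v)) (v : V) :
    vertexLabelSum G (permEdgeWeight R σ) v = 2 := by
  have hpre : G.Adj v (σ.symm v) := by simpa using (hσ (σ.symm v)).symm
  simp [vertexLabelSum, permEdgeWeight, Finset.sum_add_distrib,
    fun x => (σ.eq_symm_apply (x := v) (y := x)).symm, hσ, hpre, one_add_one_eq_two]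

/-- Every even constant is a magic sum of an even-regular graph for an even modulus. -/
theorem IsRegularDeg.isSumMagic_two_mul {V : Type*} [Fintype V] {G : SimpleGraph V} {r k : ℕ}
    [NeZero k] (hr : 0 < r) (hk : Even k) (hreg : IsRegularDeg G (2 * r)) (m : ZMod k) :
    IsSumMagic G k (2 * m) := by
  obtain ⟨σ, hσ⟩ := hreg.exists_perm_adj (by lia)
  obtain ⟨j, hj⟩ := hk
  have hkpos := NeZero.pos k
  have hhalf : (j : ZMod k) ≠ 0 := by
    rw [Ne, ZMod.natCast_eq_zero_iff]
    intro hdvd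
    have := Nat.le_of_dvd (by lia) hdvd
    lia
  have htwo : (2 : ZMod k) * j = 0 := by
    have : ((j + j : ℕ) : ZMod k) = 0 := by rw [← hj, ZMod.natCast_self]
    rw [two_mul]
    exact_mod_cast this
  have hone : ∀ x : ZMod k, 1 + 2 * x ≠ 0 := by
    intro x hx
    have h2 : 2 ∣ k := ⟨j, by lia⟩
    have := congrArg (ZMod.castHom h2 (ZMod 2)) hx
    rw [map_add, map_mul, map_one, map_zero, map_ofNat,
      show (OfNat.ofNat 2 : ZMod 2) = 0 from rfl, zero_mul, add_zero] at this
    exact one_ne_zero this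
  obtain ⟨a, ha, hane⟩ : ∃ a : ZMod k, 2 * r + a * 2 = 2 * m ∧ 1 + a ≠ 0 := by
    by_cases h : 1 + (m - r) = 0
    · refine ⟨m - r + j, by linear_combination htwo, ?_⟩
      rwa [← add_assoc, h, zero_add]
    · exact ⟨m - r, by ring, h⟩
  refine ⟨fun e => 1 + a * permEdgeWeight (ZMod k) σ e, ?_, ?_⟩
  · intro e _
    induction e with
    | _ x y =>
      have h1 : (1 : ZMod k) ≠ 0 := by simpa using hone 0
      have h2 : 1 + a * (1 + 1) ≠ 0 := by
        rw [one_add_one_eq_two, mul_comm]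
        exact hone a
      by_cases hx : σ x = y <;> by_cases hy : σ y = x <;>
        simp [permEdgeWeight, hx, hy, h1, h2, hane]
  · intro v
    have hdeg := hreg v
    have hw := vertexLabelSum_permEdgeWeight (ZMod k) hσ v
    unfold vertexLabelSum at hw ⊢
    unfold degreeOf at hdeg
    rw [Finset.sum_add_distrib, ← Finset.mul_sum, hw, Finset.sum_const, hdeg, ← ha]
    simp

/-- For even `k ≥ 6`, the sum spectrum of a `2r`-regular graph of odd order `n ≥ 3`
is exactly the set of even residues in `ZMod k`. -/
theorem even_regular_odd_order_spectrum {V : Type*} [Fintype V]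
    (G : SimpleGraph V) (r k : ℕ) (hr : 2 ≤ r) (hk : 6 ≤ k) (hkeven : Even k)
    (hreg : IsRegularDeg G (2 * r)) (hn : 3 ≤ Fintype.card V)
    (hodd : Odd (Fintype.card V)) :
    sumSpectrum G k = {c : ZMod k | ∃ m : ZMod k, c = 2 * m} := by
  have : NeZero k := ⟨by lia⟩
  ext c
  constructor
  · exact fun h => IsSumMagic.exists_eq_two_mul h hkeven hodd
  · rintro ⟨m, rfl⟩
    exact hreg.isSumMagic_two_mul (by lia) hkeven m
end

section
/- Let k ≥ 3 be an integer and G a 2-regular finite simple graph with at least one vertex. If G contains a cycle of odd length, then Σ_k(G) = ℤ_k \ {0} when k is odd, and Σ_k(G) = {0, 2, 4, …, k−2} (the set of c ∈ ℤ_k with c = 2m for some m ∈ ℤ_k) when k is even. If every cycle of G has even length, then Σ_k(G) = ℤ_k. -/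
namespace SimpleGraph

variable {V : Type*} {G : SimpleGraph V}

/-- If all cycles are even, shortcutting a walk to a path preserves the parity of its length. -/
theorem Walk.even_length_bypass_iff [DecidableEq V]
    (hG : ∀ (v : V) (p : G.Walk v v), p.IsCycle → Even p.length) {u v : V} (p : G.Walk u v) :
    Even p.bypass.length ↔ Even p.length := by
  induction p with
  | nil => simp [Walk.bypass]
  | @cons u v w h p ih =>
    rw [Walk.length_cons, Nat.even_add_one, ← ih, Walk.bypass]
    split_ifs with hs
    · have hlen := congrArg Walk.length (p.bypass.take_spec hs)
      rw [Walk.length_append] at hlen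
      have hpath := (p.bypass_isPath).takeUntil hs
      have hodd : Odd (p.bypass.takeUntil u hs).length := by
        by_cases he : s(u, v) ∈ (p.bypass.takeUntil u hs).edges
        · rw [hpath.length_eq_one_of_mem_edges (Sym2.eq_swap ▸ he)]
          exact odd_one
        · have hcyc := hG u _ ((Walk.cons_isCycle_iff _ h).2 ⟨hpath, he⟩)
          rwa [Walk.length_cons, Nat.even_add_one, Nat.not_even_iff_odd] at hcyc
      rw [← hlen, Nat.even_add]
      have := Nat.not_even_iff_odd.2 hodd
      tauto
    · rw [Walk.length_cons, Nat.even_add_one]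

/-- A graph without odd cycles is bipartite. -/
theorem isBipartite_of_forall_isCycle_even
    (hG : ∀ (v : V) (p : G.Walk v v), p.IsCycle → Even p.length) : G.IsBipartite := by
  classical
  refine two_colorable_iff_forall_loop_even.2 fun v p ↦ ?_
  rw [← Walk.even_length_bypass_iff hG p, (Walk.isPath_iff_nil.1 p.bypass_isPath).eq_nil]
  simp

/-- In a regular graph of positive degree, every set of vertices has at least as many neighbors
as elements. -/
theorem IsRegularOfDegree.ncard_le_ncard_iUnion_neighborSet [Fintype V] [DecidableRel G.Adj]
    {d : ℕ} (hG : G.IsRegularOfDegree d) (hd : 0 < d) (s : Set V) :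
    s.ncard ≤ (⋃ x ∈ s, G.neighborSet x).ncard := by
  classical
  have hmul := Finset.card_mul_le_card_mul (s := s.toFinset)
    (t := (⋃ x ∈ s, G.neighborSet x).toFinset) (m := d) (n := d) G.Adj
    (fun a ha ↦ by
      rw [← hG a, ← card_neighborFinset_eq_degree]
      refine Finset.card_le_card fun b hb ↦ ?_
      simp only [Finset.mem_bipartiteAbove, Set.mem_toFinset, Set.mem_iUnion, mem_neighborSet,
        mem_neighborFinset] at ha hb ⊢
      exact ⟨⟨a, ha, hb⟩, hb⟩)
    (fun b _ ↦ by
      rw [← hG b, ← card_neighborFinset_eq_degree]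
      refine Finset.card_le_card fun a ha ↦ ?_
      rw [Finset.mem_bipartiteBelow] at ha
      exact (mem_neighborFinset _ _ _).2 ha.2.symm)
  rw [Set.ncard_eq_toFinset_card', Set.ncard_eq_toFinset_card']
  exact Nat.le_of_mul_le_mul_right hmul hd

/-- A bipartite regular graph of positive degree has a perfect matching. -/
theorem IsRegularOfDegree.exists_isPerfectMatching [Fintype V] [DecidableRel G.Adj]
    {d : ℕ} (hG : G.IsRegularOfDegree d) (hd : 0 < d) (hbip : G.IsBipartite) :
    ∃ M : Subgraph G, M.IsPerfectMatching := by
  obtain ⟨s, t, hst⟩ := hbip.exists_isBipartiteWith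
  exact exists_isPerfectMatching_of_forall_ncard_le hst
    (hG.ncard_le_ncard_iUnion_neighborSet hd)

end SimpleGraph

section TwoRegular

variable {V : Type*} [Fintype V] {G : SimpleGraph V}

theorem IsRegularDeg.isRegularOfDegree [DecidableRel G.Adj] {r : ℕ} (h : IsRegularDeg G r) :
    G.IsRegularOfDegree r := by
  intro v
  rw [← h v, ← SimpleGraph.card_neighborFinset_eq_degree, degreeOf]
  congr 1
  ext u
  simp

theorem vertexLabelSum_eq_add (hreg : IsRegularDeg G 2) {M : Type*} [AddCommMonoid M]
    (ℓ : Sym2 V → M) {v x y : V} (hx : G.Adj v x) (hy : G.Adj v y) (hxy : x ≠ y) :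
    vertexLabelSum G ℓ v = ℓ s(v, x) + ℓ s(v, y) := by
  classical
  have hv := hreg v
  rw [degreeOf] at hv
  have hset : ({x, y} : Finset V) = Finset.univ.filter (fun u ↦ G.Adj v u) := by
    refine Finset.eq_of_subset_of_card_le ?_ ?_
    · simp [Finset.insert_subset_iff, hx, hy]
    · rw [Finset.card_pair hxy]
      convert hv.le
  rw [← Finset.sum_pair (f := fun u ↦ ℓ s(v, u)) hxy, hset, vertexLabelSum]

theorem exists_adj_ne (hreg : IsRegularDeg G 2) (v x : V) :
    ∃ y, G.Adj v y ∧ x ≠ y := by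
  classical
  have hv := hreg v
  rw [degreeOf] at hv
  obtain ⟨y, hy, hyx⟩ := Finset.exists_mem_ne (by rw [hv]; norm_num) x
  exact ⟨y, (Finset.mem_filter.1 hy).2, hyx.symm⟩

theorem isSumMagic_two_mul (hreg : IsRegularDeg G 2) {k : ℕ} {m : ZMod k} (hm : m ≠ 0) :
    IsSumMagic G k (2 * m) := by
  refine ⟨fun _ ↦ m, fun _ _ ↦ hm, fun v ↦ ?_⟩
  have hv := hreg v
  rw [degreeOf] at hv
  rw [vertexLabelSum, Finset.sum_const, hv, two_nsmul, two_mul]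

/-- A perfect matching lets the labels alternate between `a` and `c - a`. -/
theorem isSumMagic_of_isPerfectMatching (hreg : IsRegularDeg G 2) {k : ℕ} {a c : ZMod k}
    (ha : a ≠ 0) (hac : a ≠ c) {M : G.Subgraph} (hM : M.IsPerfectMatching) :
    IsSumMagic G k c := by
  classical
  refine ⟨fun e ↦ if e ∈ M.edgeSet then a else c - a, fun e _ ↦ ?_, fun v ↦ ?_⟩
  · dsimp only
    split_ifs
    · exact ha
    · exact sub_ne_zero.2 hac.symm
  · obtain ⟨x, hx, hux⟩ := SimpleGraph.Subgraph.isPerfectMatching_iff.1 hM v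
    obtain ⟨y, hy, hxy⟩ := exists_adj_ne hreg v x
    rw [vertexLabelSum_eq_add hreg _ hx.adj_sub hy hxy]
    have hny : ¬ M.Adj v y := fun h ↦ hxy (hux y h).symm
    simp [hx, hny]

/-- Labels alternate around a cycle, so an odd cycle forces the sum to be twice a label. -/
theorem exists_ne_zero_eq_two_mul (hreg : IsRegularDeg G 2) {k : ℕ} {c : ZMod k}
    (hc : IsSumMagic G k c) {v : V} {p : G.Walk v v} (hp : p.IsCycle) (hodd : Odd p.length) :
    ∃ m : ZMod k, m ≠ 0 ∧ c = 2 * m := by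
  obtain ⟨ℓ, hne, hsum⟩ := hc
  set e : ℕ → ZMod k := fun i ↦ ℓ s(p.getVert i, p.getVert (i + 1)) with he
  have hadj {i : ℕ} (hi : i < p.length) : G.Adj (p.getVert i) (p.getVert (i + 1)) :=
    p.adj_getVert_succ hi
  have hstep (i : ℕ) (hi : i + 1 < p.length) : e i + e (i + 1) = c := by
    have hne' : p.getVert i ≠ p.getVert (i + 2) := by
      simpa using hp.getVert_sub_one_ne_getVert_add_one (i := i + 1) hi.le
    rw [← hsum (p.getVert (i + 1)),
      vertexLabelSum_eq_add hreg ℓ (hadj (by lia)).symm (hadj hi) hne']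
    simp only [he]
    rw [Sym2.eq_swap]
  have heven (j : ℕ) (hj : 2 * j < p.length) : e (2 * j) = e 0 := by
    induction j with
    | zero => rfl
    | succ j ih =>
      rw [← ih (by lia)]
      have h₁ := hstep (2 * j) (by lia)
      have h₂ := hstep (2 * j + 1) (by lia)
      rw [add_comm] at h₁
      exact (add_left_cancel (h₁.trans h₂.symm)).symm
  obtain ⟨n, hn⟩ := hodd
  have hlast := heven n (by lia)
  have hclose := vertexLabelSum_eq_add hreg ℓ (p.adj_snd hp.not_nil)
    (p.adj_penultimate hp.not_nil).symm hp.snd_ne_penultimate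
  refine ⟨e 0, hne _ (hadj (by lia)), ?_⟩
  rw [hsum] at hclose
  rw [hclose, two_mul]
  nth_rw 2 [← hlast]
  have hend : p.getVert (2 * n + 1) = v := by rw [← hn, p.getVert_length]
  simp only [he, hend, SimpleGraph.Walk.getVert_zero]
  rw [Sym2.eq_swap (a := v) (b := p.penultimate)]
  simp [SimpleGraph.Walk.snd, SimpleGraph.Walk.penultimate, hn]

end TwoRegular

/-- Sum spectrum of a `2`-regular graph: if it contains an odd cycle then the spectrum is
the nonzero residues (for odd `k`) or the even residues (for even `k`); if all cycles are
even then the spectrum is all of `ZMod k`. -/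
theorem two_regular_spectrum {V : Type*} [Fintype V] (G : SimpleGraph V)
    (k : ℕ) (hk : 3 ≤ k) (hreg : IsRegularDeg G 2) (hn : 1 ≤ Fintype.card V) :
    ((∃ (v : V) (p : G.Walk v v), p.IsCycle ∧ Odd p.length) →
      ((Odd k → sumSpectrum G k = {c : ZMod k | c ≠ 0}) ∧
       (Even k → sumSpectrum G k = {c : ZMod k | ∃ m : ZMod k, c = 2 * m}))) ∧
    ((∀ (v : V) (p : G.Walk v v), p.IsCycle → Even p.length) →
      sumSpectrum G k = Set.univ) := by
  have : Fact (1 < k) := ⟨by lia⟩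
  have : NeZero k := ⟨by lia⟩
  refine ⟨fun ⟨v, p, hp, hodd⟩ ↦ ⟨fun hk_odd ↦ ?_, fun hk_even ↦ ?_⟩, fun hG ↦ ?_⟩
  · have h2 : IsUnit (2 : ZMod k) := by
      have := (ZMod.isUnit_iff_coprime 2 k).2 (Nat.coprime_two_left.2 hk_odd)
      exact_mod_cast this
    ext c
    constructor
    · intro hc
      obtain ⟨m, hm, rfl⟩ := exists_ne_zero_eq_two_mul hreg hc hp hodd
      exact fun h ↦ hm (h2.mul_right_eq_zero.1 h)
    · intro hc
      obtain ⟨m, rfl⟩ := h2.dvd (a := c)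
      exact isSumMagic_two_mul hreg fun h ↦ hc (by rw [h, mul_zero])
  · ext c
    constructor
    · intro hc
      obtain ⟨m, -, rfl⟩ := exists_ne_zero_eq_two_mul hreg hc hp hodd
      exact ⟨m, rfl⟩
    · rintro ⟨m, rfl⟩
      by_cases hm : m = 0
      · obtain ⟨j, hj⟩ := hk_even
        have hj0 : (j : ZMod k) ≠ 0 := by
          rw [Ne, ZMod.natCast_eq_zero_iff]
          exact fun h ↦ by have := Nat.le_of_dvd (by lia) h; lia
        have h2j : 2 * (j : ZMod k) = 2 * m := by
          rw [hm, mul_zero, two_mul, ← Nat.cast_add, ← hj, ZMod.natCast_self]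
        exact h2j ▸ isSumMagic_two_mul hreg hj0
      · exact isSumMagic_two_mul hreg hm
  · classical
    refine Set.eq_univ_of_forall fun c ↦ ?_
    obtain ⟨M, hM⟩ := hreg.isRegularOfDegree.exists_isPerfectMatching two_pos
      (SimpleGraph.isBipartite_of_forall_isCycle_even hG)
    obtain ⟨a, -, ha⟩ := Finset.exists_mem_notMem_of_card_lt_card
      (s := {0, c}) (t := (Finset.univ : Finset (ZMod k)))
      (Finset.card_le_two.trans_lt (by rw [Finset.card_univ, ZMod.card]; lia))
    simp only [Finset.mem_insert, Finset.mem_singleton, not_or] at ha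
    exact isSumMagic_of_isPerfectMatching hreg ha.1 ha.2 hM
end
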